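/- arXiv:2011.05661 — 2 statements merged into one kernel-verified Lean document; each statement's English description precedes it below -/
import Mathlib

section
/- Let ε, η ∈ [0,1] and let q : ℕ → ℝ be defined by q(1) = 1 - ε and q(T+1) = (1 - εη)·q(T) for all T ≥ 1. Then for every T ≥ 1, q(T) = 1 - ε·[1 + Σ_{k=2}^{T} Σ_{j=2}^{k} C(k-2, j-2)·((1-ε)·η)^{j-1}·(1-η)^{k-j}]; that is, the probability of missing a stable pose of probability ε after T rounds equals one minus the encounter-probability formula. -/
open Finset

/-- The binomial theorem with both indices shifted by two and an extra factor `a`. -/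
theorem sum_Icc_two_choose_mul_pow {R : Type*} [CommSemiring R] (a b : R) (n : ℕ) :
    ∑ j ∈ Finset.Icc 2 (n + 2),
      (Nat.choose (n + 2 - 2) (j - 2) : R) * a ^ (j - 1) * b ^ (n + 2 - j) =
        a * (a + b) ^ n := by
  rw [← Finset.Ico_add_one_right_eq_Icc, Finset.sum_Ico_eq_sum_range, add_pow, Finset.mul_sum]
  refine Finset.sum_congr (by congr 1) fun i _ => ?_
  rw [show 2 + i - 2 = i by omega, show 2 + i - 1 = i + 1 by omega,
    show n + 2 - (2 + i) = n - i by omega, Nat.add_sub_cancel]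
  ring

/-- A sequence that is multiplied by `r` at each step from index `1` on is geometric. -/
theorem eq_mul_pow_of_rec {R : Type*} [CommSemiring R] {q : ℕ → R} {r : R}
    (hq : ∀ T : ℕ, 1 ≤ T → q (T + 1) = r * q T) (n : ℕ) :
    q (n + 1) = q 1 * r ^ n := by
  induction n with
  | zero => simp
  | succ n ih => rw [hq (n + 1) (by omega), ih]; ring

/-- Corollary: the probability `q T` of missing a stable pose of probability `eps`
after `T` rounds equals one minus the encounter-probability formula. Here `eta`
is the probability of grasp success on all other poses and the miss probability
`q` satisfies `q 1 = 1 - eps` and `q (T+1) = (1 - eps*eta) * q T`. -/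
theorem prob_miss_pose
    (eps eta : ℝ) (heps : eps ∈ Set.Icc (0:ℝ) 1) (heta : eta ∈ Set.Icc (0:ℝ) 1)
    (q : ℕ → ℝ) (hq1 : q 1 = 1 - eps)
    (hqrec : ∀ T : ℕ, 1 ≤ T → q (T + 1) = (1 - eps * eta) * q T) :
    ∀ T : ℕ, 1 ≤ T →
      q T =
        1 - eps * (1 + ∑ k ∈ Finset.Icc 2 T, ∑ j ∈ Finset.Icc 2 k,
          (Nat.choose (k - 2) (j - 2) : ℝ) * ((1 - eps) * eta) ^ (j - 1)
            * (1 - eta) ^ (k - j)) := by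
  intro T hT
  induction T, hT using Nat.le_induction with
  | base => simp [hq1]
  | succ T hT ih =>
    obtain ⟨n, rfl⟩ := Nat.exists_eq_add_of_le' hT
    rw [Finset.sum_Icc_succ_top (by omega), sum_Icc_two_choose_mul_pow,
      show (1 - eps) * eta + (1 - eta) = 1 - eps * eta by ring]
    have hgeom := eq_mul_pow_of_rec hqrec n
    rw [hq1] at hgeom
    rw [hqrec (n + 1) hT]
    linear_combination ih - eps * eta * hgeom
end

section
/- For all real λ, η ∈ [0,1] and every integer T ≥ 1, λ·[1 + Σ_{k=2}^{T} Σ_{j=2}^{k} C(k-2, j-2)·((1-λ)·η)^{j-1}·(1-η)^{k-j}] = 1 - (1-λ)·(1-λη)^{T-1}. -/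
open Finset

/-- Closed form: the pose-coverage double-sum expression for the probability of
encountering a stable pose of probability `lam` within `T` steps (with
per-step grasp-success probability `eta` on other poses) equals the simplified
geometric form `1 - (1-lam)*(1-lam*eta)^(T-1)`. -/
theorem pose_coverage_closed_form
    (lam eta : ℝ) (hlam : lam ∈ Set.Icc (0:ℝ) 1) (heta : eta ∈ Set.Icc (0:ℝ) 1) :
    ∀ T : ℕ, 1 ≤ T →
      lam * (1 + ∑ k ∈ Finset.Icc 2 T, ∑ j ∈ Finset.Icc 2 k,
          (Nat.choose (k - 2) (j - 2) : ℝ) * ((1 - lam) * eta) ^ (j - 1)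
            * (1 - eta) ^ (k - j))
        = 1 - (1 - lam) * (1 - lam * eta) ^ (T - 1) := by
  intro T hT
  induction T, hT using Nat.le_induction with
  | base => simp
  | succ n hn ih =>
    obtain ⟨m, rfl⟩ := Nat.exists_eq_add_of_le' hn
    rw [Finset.sum_Icc_succ_top (by omega), sum_Icc_two_choose_mul_pow, ← add_assoc, mul_add, ih,
      show (1 - lam) * eta + (1 - eta) = 1 - lam * eta by ring, Nat.add_sub_cancel,
      Nat.add_sub_cancel]
    ring
end
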